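/- Let Γ be the group with presentation ⟨x, y ∣ x = ω⁻¹νω⁻¹ν, y = νω⁻¹νω⁻¹⟩, where ω = x⁻¹yxy⁻¹ and ν = xy⁻¹x⁻¹y (the fundamental group of the closed hyperbolic 3-manifold obtained by −1/2 Dehn surgery on the figure-eight knot). Then the conjugation action of SL(2,ℂ) on the set of nontrivial group homomorphisms Γ → SL(2,ℂ) has exactly 7 orbits. -/

import Mathlib

/-- The relators of the fundamental group of the `−1/2` Dehn surgery on the
figure-eight knot: generators `x = 0, y = 1` and relations `x = ω⁻¹νω⁻¹ν`,
`y = νω⁻¹νω⁻¹` where `ω = x⁻¹yxy⁻¹` and `ν = xy⁻¹x⁻¹y`. -/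
def figure8SurgeryRels : Set (FreeGroup (Fin 2)) :=
  let x : FreeGroup (Fin 2) := FreeGroup.of 0
  let y : FreeGroup (Fin 2) := FreeGroup.of 1
  let ω : FreeGroup (Fin 2) := x⁻¹ * y * x * y⁻¹
  let ν : FreeGroup (Fin 2) := x * y⁻¹ * x⁻¹ * y
  {x * (ω⁻¹ * ν * ω⁻¹ * ν)⁻¹, y * (ν * ω⁻¹ * ν * ω⁻¹)⁻¹}

open Matrix Polynomial
open scoped MatrixGroups

section Group

variable {G H : Type*} [Group G] [Group H]

/-- The word `ω = x⁻¹yxy⁻¹`. -/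
def omegaWord (x y : G) : G := x⁻¹ * y * x * y⁻¹

/-- The word `ν = xy⁻¹x⁻¹y`. -/
def nuWord (x y : G) : G := x * y⁻¹ * x⁻¹ * y

/-- A pair of group elements satisfying the relations `x = ω⁻¹νω⁻¹ν`, `y = νω⁻¹νω⁻¹`. -/
structure IsSurgeryPair (x y : G) : Prop where
  left_eq : x = (omegaWord x y)⁻¹ * nuWord x y * (omegaWord x y)⁻¹ * nuWord x y
  right_eq : y = nuWord x y * (omegaWord x y)⁻¹ * nuWord x y * (omegaWord x y)⁻¹

/-- The word `ω⁻¹ν`, representing the longitude of the knot. -/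
def longitudeWord (x y : G) : G := (omegaWord x y)⁻¹ * nuWord x y

lemma map_omegaWord (φ : G →* H) (x y : G) :
    φ (omegaWord x y) = omegaWord (φ x) (φ y) := by
  simp [omegaWord]

lemma map_nuWord (φ : G →* H) (x y : G) : φ (nuWord x y) = nuWord (φ x) (φ y) := by
  simp [nuWord]

lemma map_longitudeWord (φ : G →* H) (x y : G) :
    φ (longitudeWord x y) = longitudeWord (φ x) (φ y) := by
  simp [longitudeWord, map_omegaWord, map_nuWord]

lemma longitudeWord_conj (g x y : G) :
    longitudeWord (g * x * g⁻¹) (g * y * g⁻¹) = g * longitudeWord x y * g⁻¹ := by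
  simpa using (map_longitudeWord (MulAut.conj g).toMonoidHom x y).symm

namespace IsSurgeryPair

variable {x y : G}

lemma map (h : IsSurgeryPair x y) (φ : G →* H) : IsSurgeryPair (φ x) (φ y) := by
  constructor
  · simpa only [map_mul, map_inv, map_omegaWord, map_nuWord] using congrArg φ h.left_eq
  · simpa only [map_mul, map_inv, map_omegaWord, map_nuWord] using congrArg φ h.right_eq

lemma conj (h : IsSurgeryPair x y) (g : G) :
    IsSurgeryPair (g * x * g⁻¹) (g * y * g⁻¹) := by
  simpa using h.map (MulAut.conj g).toMonoidHom

lemma longitudeWord_mul_self (h : IsSurgeryPair x y) :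
    longitudeWord x y * longitudeWord x y = x := by
  conv_rhs => rw [h.left_eq]
  simp only [longitudeWord, mul_assoc]

lemma mul_omegaWord (h : IsSurgeryPair x y) : y * omegaWord x y = omegaWord x y * x := by
  have h₁ := h.left_eq
  have h₂ := h.right_eq
  generalize omegaWord x y = w at *
  generalize nuWord x y = v at *
  rw [h₁, h₂]
  group

lemma of_longitudeWord (h₁ : longitudeWord x y * longitudeWord x y = x)
    (h₂ : y * omegaWord x y = omegaWord x y * x) : IsSurgeryPair x y := by
  rw [longitudeWord] at h₁
  refine ⟨by simpa only [mul_assoc] using h₁.symm, ?_⟩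
  generalize omegaWord x y = w at *
  generalize nuWord x y = v at *
  rw [eq_mul_inv_of_mul_eq h₂, ← h₁]
  group

lemma eq_one_of_commute (h : IsSurgeryPair x y) (hc : Commute x y) : x = 1 ∧ y = 1 := by
  have hw : omegaWord x y = 1 := by
    rw [omegaWord, mul_assoc x⁻¹, ← hc.eq]
    group
  have hv : nuWord x y = 1 := by
    rw [nuWord, hc.inv_right.eq]
    group
  exact ⟨by simpa [hw, hv] using h.left_eq, by simpa [hw, hv] using h.right_eq⟩

end IsSurgeryPair

end Group

section PresentedGroup

variable {G : Type*} [Group G]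

lemma isSurgeryPair_of :
    IsSurgeryPair (PresentedGroup.of 0 : PresentedGroup figure8SurgeryRels)
      (PresentedGroup.of 1) := by
  have h₁ := PresentedGroup.one_of_mem (rels := figure8SurgeryRels) (Set.mem_insert _ _)
  have h₂ := PresentedGroup.one_of_mem (rels := figure8SurgeryRels)
    (Set.mem_insert_of_mem _ (Set.mem_singleton _))
  rw [map_mul, map_inv, mul_inv_eq_one] at h₁ h₂
  exact ⟨h₁, h₂⟩

/-- The homomorphism determined by a surgery pair. -/
def IsSurgeryPair.toHom {x y : G} (h : IsSurgeryPair x y) :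
    PresentedGroup figure8SurgeryRels →* G :=
  PresentedGroup.toGroup (f := ![x, y]) <| by
    rintro r (rfl | rfl)
    · rw [map_mul, map_inv, mul_inv_eq_one]
      simpa [omegaWord, nuWord] using h.left_eq
    · rw [map_mul, map_inv, mul_inv_eq_one]
      simpa [omegaWord, nuWord] using h.right_eq

lemma IsSurgeryPair.toHom_of_zero {x y : G} (h : IsSurgeryPair x y) :
    h.toHom (PresentedGroup.of 0) = x := by
  simp [toHom]

lemma IsSurgeryPair.toHom_of_one {x y : G} (h : IsSurgeryPair x y) :
    h.toHom (PresentedGroup.of 1) = y := by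
  simp [toHom]

lemma figure8SurgeryHom_ext {φ ψ : PresentedGroup figure8SurgeryRels →* G}
    (h₀ : φ (PresentedGroup.of 0) = ψ (PresentedGroup.of 0))
    (h₁ : φ (PresentedGroup.of 1) = ψ (PresentedGroup.of 1)) : φ = ψ :=
  PresentedGroup.ext <| Fin.forall_fin_two.2 ⟨h₀, h₁⟩

end PresentedGroup

section SpecialLinear

lemma commute_of_mulVec_eq_self {A B : SL(2, ℂ)} {v : Fin 2 → ℂ} (hv : v ≠ 0)
    (hA : A.1 *ᵥ v = v) (hB : B.1 *ᵥ v = v) : Commute A B := by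
  have hdA := A.2
  have hdB := B.2
  rw [det_fin_two] at hdA hdB
  have hA₀ := congrFun hA 0
  have hA₁ := congrFun hA 1
  have hB₀ := congrFun hB 0
  have hB₁ := congrFun hB 1
  simp only [mulVec, dotProduct, Fin.sum_univ_two] at hA₀ hA₁ hB₀ hB₁
  have hv' : v 0 ≠ 0 ∨ v 1 ≠ 0 := by
    by_contra! h
    exact hv (funext <| Fin.forall_fin_two.2 h)
  apply Subtype.ext
  change A.1 * B.1 = B.1 * A.1
  ext i j
  fin_cases i <;> fin_cases j <;>
    simp only [mul_apply, Fin.sum_univ_two, Fin.zero_eta,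
      Fin.mk_one, Fin.isValue] <;> rcases hv' with h | h <;> grind

lemma inv_mulVec_eq_smul {A : SL(2, ℂ)} {v : Fin 2 → ℂ} {a : ℂ} (ha : a ≠ 0)
    (h : A.1 *ᵥ v = a • v) : (A⁻¹).1 *ᵥ v = a⁻¹ • v := by
  have : (A⁻¹).1 *ᵥ (A.1 *ᵥ v) = v := by
    rw [mulVec_mulVec, ← Matrix.SpecialLinearGroup.coe_mul, inv_mul_cancel]
    simp
  rw [h, mulVec_smul] at this
  rw [← this, smul_smul, this, inv_mul_cancel₀ ha, one_smul]

lemma ne_zero_of_mulVec_eq_smul {A : SL(2, ℂ)} {v : Fin 2 → ℂ} {a : ℂ} (hv : v ≠ 0)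
    (h : A.1 *ᵥ v = a • v) : a ≠ 0 := by
  rintro rfl
  refine hv (eq_zero_of_mulVec_eq_zero (M := A.1) (by simp) ?_)
  simpa using h

/-- A surgery pair in `SL(2, ℂ)` with a common eigenvector is trivial. -/
lemma IsSurgeryPair.eq_one_of_mulVec_eq_smul {A B : SL(2, ℂ)} (h : IsSurgeryPair A B)
    {v : Fin 2 → ℂ} (hv : v ≠ 0) {a b : ℂ} (hA : A.1 *ᵥ v = a • v) (hB : B.1 *ᵥ v = b • v) :
    A = 1 ∧ B = 1 := by
  have ha := ne_zero_of_mulVec_eq_smul hv hA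
  have hb := ne_zero_of_mulVec_eq_smul hv hB
  have hA' := inv_mulVec_eq_smul ha hA
  have hB' := inv_mulVec_eq_smul hb hB
  have hω : (omegaWord A B).1 *ᵥ v = (1 : ℂ) • v := by
    simp only [omegaWord, Matrix.SpecialLinearGroup.coe_mul, ← mulVec_mulVec, hA, hB, hA', hB',
      mulVec_smul, smul_smul]
    congr 1
    field_simp
  have hν : (nuWord A B).1 *ᵥ v = v := by
    simp only [nuWord, Matrix.SpecialLinearGroup.coe_mul, ← mulVec_mulVec, hA, hB, hA', hB',
      mulVec_smul, smul_smul]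
    convert one_smul ℂ v using 2
    field_simp
  have hω' : ((omegaWord A B)⁻¹).1 *ᵥ v = v := by
    simpa using inv_mulVec_eq_smul one_ne_zero hω
  refine h.eq_one_of_commute (commute_of_mulVec_eq_self hv ?_ ?_)
  · rw [h.left_eq]
    simp only [Matrix.SpecialLinearGroup.coe_mul, ← mulVec_mulVec, hω', hν]
  · rw [h.right_eq]
    simp only [Matrix.SpecialLinearGroup.coe_mul, ← mulVec_mulVec, hω', hν]

/-- The upper triangular matrix `(m, p; 0, n)`. -/
def upperTriangularSL (m n p : ℂ) (h : m * n = 1) : SL(2, ℂ) :=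
  ⟨!![m, p; 0, n], by simp [h]⟩

lemma coe_upperTriangularSL (m n p : ℂ) (h : m * n = 1) :
    (upperTriangularSL m n p h : Matrix (Fin 2) (Fin 2) ℂ) = !![m, p; 0, n] := rfl

/-- The companion matrix `(0, -1; 1, b)`. -/
def companionSL (b : ℂ) : SL(2, ℂ) :=
  ⟨!![0, -1; 1, b], by simp⟩

lemma coe_companionSL (b : ℂ) :
    (companionSL b : Matrix (Fin 2) (Fin 2) ℂ) = !![0, -1; 1, b] := rfl

lemma trace_conj_SL (g A : SL(2, ℂ)) : (g * A * g⁻¹).1.trace = A.1.trace := by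
  rw [Matrix.SpecialLinearGroup.coe_mul, trace_mul_comm, ← Matrix.SpecialLinearGroup.coe_mul, ← mul_assoc,
    inv_mul_cancel, one_mul]

/-- Two matrices in `SL(2, ℂ)` without common eigenvector are simultaneously conjugate to a
triangular and a companion matrix. -/
lemma exists_conj_upperTriangularSL_companionSL {A B : SL(2, ℂ)}
    (hirr : ∀ v ≠ 0, ∀ a b : ℂ, A.1 *ᵥ v = a • v → B.1 *ᵥ v ≠ b • v)
    {m n : ℂ} (hmn : m * n = 1) (htr : A.1.trace = m + n) :
    ∃ g : SL(2, ℂ), A = g * upperTriangularSL m n ((A * B).1.trace - n * B.1.trace) hmn * g⁻¹ ∧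
      B = g * companionSL B.1.trace * g⁻¹ := by
  have hdA := A.2
  have hdB := B.2
  rw [det_fin_two] at hdA hdB
  simp only [Matrix.SpecialLinearGroup.coe_mul, trace_fin_two, mul_apply, Fin.sum_univ_two] at htr ⊢
  obtain ⟨v, hv, hAv⟩ : ∃ v : Fin 2 → ℂ, v ≠ 0 ∧ A.1 *ᵥ v = m • v := by
    have hdet : (A.1 - scalar (Fin 2) m).det = 0 := by
      simp [det_fin_two]
      grind
    obtain ⟨v, hv, hAv⟩ := exists_mulVec_eq_zero_iff.2 hdet
    refine ⟨v, hv, ?_⟩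
    rw [sub_mulVec, sub_eq_zero] at hAv
    simpa using hAv
  have hd : v 0 * (B.1 *ᵥ v) 1 - (B.1 *ᵥ v) 0 * v 1 ≠ 0 := by
    intro hd
    by_cases h0 : v 0 = 0
    · have h1 : v 1 ≠ 0 := fun h1 => hv (funext <| Fin.forall_fin_two.2 ⟨h0, h1⟩)
      refine hirr v hv m ((B.1 *ᵥ v) 1 / v 1) hAv (funext <| Fin.forall_fin_two.2 ⟨?_, ?_⟩) <;>
        (simp only [Pi.smul_apply, smul_eq_mul]; field_simp <;> grind)
    · refine hirr v hv m ((B.1 *ᵥ v) 0 / v 0) hAv (funext <| Fin.forall_fin_two.2 ⟨?_, ?_⟩) <;>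
        (simp only [Pi.smul_apply, smul_eq_mul]; field_simp <;> grind)
  obtain ⟨r, hr⟩ := IsAlgClosed.exists_eq_mul_self (v 0 * (B.1 *ᵥ v) 1 - (B.1 *ᵥ v) 0 * v 1)
  have hr0 : r ≠ 0 := by
    rintro rfl
    exact hd (by simpa using hr)
  obtain ⟨g, hg⟩ : ∃ g : SL(2, ℂ),
      (g : Matrix (Fin 2) (Fin 2) ℂ) =
        !![v 0 / r, (B.1 *ᵥ v) 0 / r; v 1 / r, (B.1 *ᵥ v) 1 / r] :=
    ⟨⟨_, by rw [det_fin_two_of]; field_simp; grind⟩, rfl⟩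
  have hA₀ := congrFun hAv 0
  have hA₁ := congrFun hAv 1
  simp only [mulVec, dotProduct, Fin.sum_univ_two, Pi.smul_apply, smul_eq_mul] at hA₀ hA₁
  clear hirr hv hAv hd
  refine ⟨g, ?_, ?_⟩ <;> rw [eq_mul_inv_iff_mul_eq] <;> ext i j <;>
    fin_cases i <;> fin_cases j <;>
    simp only [hg, coe_upperTriangularSL, coe_companionSL, Matrix.SpecialLinearGroup.coe_mul, mul_apply,
      mulVec, dotProduct, Fin.sum_univ_two, of_apply, cons_val', cons_val_zero, cons_val_one,
      cons_val_fin_one, Fin.zero_eta, Fin.mk_one, Fin.isValue] <;>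
    field_simp <;> grind

end SpecialLinear

section TraceEquations

lemma trace_smul_SL (L : SL(2, ℂ)) : L.1.trace • L.1 = L.1 * L.1 + 1 := by
  have hd := L.2
  rw [det_fin_two] at hd
  ext i j
  fin_cases i <;> fin_cases j <;>
    simp [trace_fin_two, mul_apply, Fin.sum_univ_two] <;> grind

lemma trace_mul_self_SL (L : SL(2, ℂ)) : (L * L).1.trace = L.1.trace ^ 2 - 2 := by
  have h := congrArg trace (trace_smul_SL L)
  rw [trace_smul, trace_add, trace_one, Fintype.card_fin, smul_eq_mul] at h
  rw [Matrix.SpecialLinearGroup.coe_mul]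
  push_cast at h
  linear_combination -h

namespace IsSurgeryPair

variable {A B : SL(2, ℂ)}

lemma trace_left (h : IsSurgeryPair A B) :
    A.1.trace = (longitudeWord A B).1.trace ^ 2 - 2 := by
  rw [← trace_mul_self_SL, h.longitudeWord_mul_self]

lemma trace_right (h : IsSurgeryPair A B) : B.1.trace = A.1.trace := by
  rw [eq_mul_inv_of_mul_eq h.mul_omegaWord, trace_conj_SL]

lemma trace_smul_nuWord (h : IsSurgeryPair A B) :
    (longitudeWord A B).1.trace • (nuWord A B).1 = (omegaWord A B).1 * (A.1 + 1) := by
  have hν : nuWord A B = omegaWord A B * longitudeWord A B := by simp [longitudeWord]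
  have hA : A.1 = (longitudeWord A B).1 * (longitudeWord A B).1 := by
    rw [← Matrix.SpecialLinearGroup.coe_mul, h.longitudeWord_mul_self]
  rw [hA, ← trace_smul_SL, hν, Matrix.SpecialLinearGroup.coe_mul, Matrix.mul_smul]

lemma iff_matrix {s : ℂ} (hs : s ≠ 0) (htr : A.1.trace = s ^ 2 - 2) :
    IsSurgeryPair A B ∧ (longitudeWord A B).1.trace = s ↔
      B.1 * (omegaWord A B).1 = (omegaWord A B).1 * A.1 ∧
        s • (nuWord A B).1 = (omegaWord A B).1 * (A.1 + 1) := by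
  constructor
  · rintro ⟨h, rfl⟩
    exact ⟨congrArg Subtype.val h.mul_omegaWord, h.trace_smul_nuWord⟩
  · rintro ⟨h₁, h₂⟩
    have hL : s • (longitudeWord A B).1 = A.1 + 1 := by
      rw [longitudeWord, Matrix.SpecialLinearGroup.coe_mul, ← Matrix.mul_smul, h₂, ← mul_assoc,
        ← Matrix.SpecialLinearGroup.coe_mul, inv_mul_cancel, Matrix.SpecialLinearGroup.coe_one,
        one_mul]
    have htrL : (longitudeWord A B).1.trace = s := by
      have := congrArg trace hL
      rw [trace_smul, trace_add, trace_one, htr, Fintype.card_fin, smul_eq_mul] at this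
      push_cast at this
      exact mul_left_cancel₀ hs (by linear_combination this)
    refine ⟨of_longitudeWord (Subtype.ext ?_) (Subtype.ext h₁), htrL⟩
    rw [Matrix.SpecialLinearGroup.coe_mul]
    have := trace_smul_SL (longitudeWord A B)
    rw [htrL, hL] at this
    exact (add_right_cancel this).symm

end IsSurgeryPair

lemma coe_omegaWord_normalForm {m n p b : ℂ} (hmn : m * n = 1) :
    (omegaWord (upperTriangularSL m n p hmn) (companionSL b)).1 =
      !![n, -p; 0, m] * !![0, -1; 1, b] * !![m, p; 0, n] * !![b, 1; -1, 0] := by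
  simp [omegaWord, coe_upperTriangularSL, coe_companionSL, adjugate_fin_two]

lemma coe_nuWord_normalForm {m n p b : ℂ} (hmn : m * n = 1) :
    (nuWord (upperTriangularSL m n p hmn) (companionSL b)).1 =
      !![m, p; 0, n] * !![b, 1; -1, 0] * !![n, -p; 0, m] * !![0, -1; 1, b] := by
  simp [nuWord, coe_upperTriangularSL, coe_companionSL, adjugate_fin_two]

/-- The equations cutting out the normal forms of surgery pairs: `t`, `c`, `s` are the traces of
`x`, `xy` and of the longitude. -/
lemma isSurgeryPair_normalForm_iff {m n p s t c : ℂ} (hmn : m * n = 1) (ht : m + n = t)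
    (hc : p + n * t = c) (hs : s ≠ 0) (hst : t = s ^ 2 - 2) :
    (IsSurgeryPair (upperTriangularSL m n p hmn) (companionSL t) ∧
      (longitudeWord (upperTriangularSL m n p hmn) (companionSL t)).1.trace = s) ↔
      c ^ 2 - (1 + t ^ 2) * c + 2 * t ^ 2 - 1 = 0 ∧ (s - 1) * (c - 1) = t := by
  rw [IsSurgeryPair.iff_matrix hs (by simp [coe_upperTriangularSL, ht, hst]),
    coe_omegaWord_normalForm, coe_nuWord_normalForm, coe_upperTriangularSL, coe_companionSL]
  constructor
  · rintro ⟨h₁, h₂⟩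
    have h₁' := congrFun₂ h₁ 1 0
    have h₂' := congrArg trace h₂
    rw [mul_add, mul_one] at h₂'
    simp [mul_apply, trace_fin_two, Fin.sum_univ_two] at h₁' h₂'
    have hR : c ^ 2 - (1 + t ^ 2) * c + 2 * t ^ 2 - 1 = 0 := by grind
    exact ⟨hR, by grind⟩
  · rintro ⟨hR, h⟩
    constructor <;> ext i j <;> fin_cases i <;> fin_cases j <;>
      simp [mul_apply, Fin.sum_univ_two] <;> grind

end TraceEquations

section Classification

/-- The polynomial whose roots are the traces of the longitude under the nontrivial
representations. -/
noncomputable def longitudeTracePoly : ℂ[X] :=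
  (X ^ 4 - 4 * X ^ 2 + 3) * (X - 1) * (X ^ 2 - X - 1) - (X ^ 2 - 2) ^ 2

lemma eval_longitudeTracePoly (s : ℂ) :
    longitudeTracePoly.eval s =
      (s ^ 4 - 4 * s ^ 2 + 3) * (s - 1) * (s ^ 2 - s - 1) - (s ^ 2 - 2) ^ 2 := by
  simp [longitudeTracePoly]

lemma longitudeTracePoly_eq :
    longitudeTracePoly =
      X ^ 7 - 2 * X ^ 6 - 4 * X ^ 5 + 8 * X ^ 4 + 3 * X ^ 3 - 6 * X ^ 2 - 1 := by
  rw [longitudeTracePoly]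
  ring

lemma natDegree_longitudeTracePoly : longitudeTracePoly.natDegree = 7 := by
  rw [longitudeTracePoly_eq]
  compute_degree!

lemma longitudeTracePoly_ne_zero : longitudeTracePoly ≠ 0 := fun h => by
  simpa [h] using natDegree_longitudeTracePoly

lemma nodup_roots_longitudeTracePoly : longitudeTracePoly.roots.Nodup := by
  rw [Multiset.nodup_iff_count_le_one]
  intro s
  rw [count_roots]
  by_contra! h
  obtain ⟨h₁, h₂⟩ := (one_lt_rootMultiplicity_iff_isRoot longitudeTracePoly_ne_zero).1 h
  rw [IsRoot, eval_longitudeTracePoly] at h₁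
  simp [longitudeTracePoly_eq] at h₂
  grind

lemma card_isRoot_longitudeTracePoly :
    Nat.card {s : ℂ // longitudeTracePoly.IsRoot s} = 7 := by
  rw [Nat.card_congr (Equiv.subtypeEquivRight (q := (· ∈ longitudeTracePoly.roots.toFinset))
      fun s => by simp [longitudeTracePoly_ne_zero]),
    Nat.card_eq_fintype_card, Fintype.card_coe,
    Multiset.toFinset_card_of_nodup nodup_roots_longitudeTracePoly,
    IsAlgClosed.card_roots_eq_natDegree, natDegree_longitudeTracePoly]

/-- The trace of `xy` in terms of the trace `s` of the longitude. -/
noncomputable def traceMul (s : ℂ) : ℂ := 1 + (s ^ 2 - 2) / (s - 1)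

lemma longitudeTrace_equations_iff {s t c : ℂ} (hs : t = s ^ 2 - 2) :
    c ^ 2 - (1 + t ^ 2) * c + 2 * t ^ 2 - 1 = 0 ∧ (s - 1) * (c - 1) = t ↔
      longitudeTracePoly.IsRoot s ∧ c = traceMul s := by
  rw [IsRoot, eval_longitudeTracePoly, traceMul]
  constructor
  · rintro ⟨h₁, h₂⟩
    have : s - 1 ≠ 0 := fun h => by grind
    constructor
    · grind
    · field_simp
      grind
  · rintro ⟨h, rfl⟩
    have : s - 1 ≠ 0 := fun h => by grind
    constructor
    · field_simp
      grind
    · field_simp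
      grind

lemma exists_mul_eq_one_add_eq (t : ℂ) : ∃ m n : ℂ, m * n = 1 ∧ m + n = t := by
  obtain ⟨r, hr⟩ := IsAlgClosed.exists_eq_mul_self (t ^ 2 - 4)
  exact ⟨(t + r) / 2, (t - r) / 2, by linear_combination hr / 4, by ring⟩

lemma IsSurgeryPair.trace_longitudeWord_ne_zero {A B : SL(2, ℂ)} (h : IsSurgeryPair A B)
    (hne : ¬(A = 1 ∧ B = 1)) : (longitudeWord A B).1.trace ≠ 0 := by
  intro hs
  have hL := trace_smul_SL (longitudeWord A B)
  rw [hs, zero_smul, ← Matrix.SpecialLinearGroup.coe_mul, h.longitudeWord_mul_self] at hL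
  have hA : A.1 = -1 := eq_neg_of_add_eq_zero_left hL.symm
  refine hne (h.eq_one_of_commute (Subtype.ext ?_))
  change A.1 * B.1 = B.1 * A.1
  rw [hA, neg_one_mul, mul_neg_one]

/-- A nontrivial surgery pair in `SL(2, ℂ)` is determined up to conjugation by the trace of its
longitude. -/
lemma IsSurgeryPair.exists_conj_normalForm {A B : SL(2, ℂ)} (h : IsSurgeryPair A B)
    (hne : ¬(A = 1 ∧ B = 1)) {s m n : ℂ} (hmn : m * n = 1) (hs : (longitudeWord A B).1.trace = s)
    (ht : m + n = s ^ 2 - 2) :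
    longitudeTracePoly.IsRoot s ∧ ∃ g : SL(2, ℂ),
      A = g * upperTriangularSL m n (traceMul s - n * (s ^ 2 - 2)) hmn * g⁻¹ ∧
      B = g * companionSL (s ^ 2 - 2) * g⁻¹ := by
  have htA : A.1.trace = m + n := by rw [h.trace_left, hs, ht]
  obtain ⟨g, hA, hB⟩ := exists_conj_upperTriangularSL_companionSL
    (fun v hv a b ha hb => hne (h.eq_one_of_mulVec_eq_smul hv ha hb)) hmn htA
  have hs0 := hs ▸ h.trace_longitudeWord_ne_zero hne
  rw [h.trace_right, htA, ht] at hA hB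
  generalize hp : (A * B).1.trace - n * (s ^ 2 - 2) = p at hA
  have h' : IsSurgeryPair (upperTriangularSL m n p hmn) (companionSL (s ^ 2 - 2)) := by
    convert h.conj g⁻¹ using 1
    · rw [hA]
      group
    · rw [hB]
      group
  have hs' := hs
  rw [hA, hB, longitudeWord_conj, trace_conj_SL] at hs'
  obtain ⟨hroot, hc⟩ := (longitudeTrace_equations_iff rfl).1 <|
    (isSurgeryPair_normalForm_iff hmn ht (sub_add_cancel _ _) hs0 rfl).1 ⟨hp ▸ h', hp ▸ hs'⟩
  exact ⟨hroot, g, by rw [← hc, hp]; exact hA, hB⟩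

lemma exists_surgeryPair_of_isRoot {s : ℂ} (hs : longitudeTracePoly.IsRoot s) :
    ∃ A B : SL(2, ℂ), IsSurgeryPair A B ∧ ¬(A = 1 ∧ B = 1) ∧
      (longitudeWord A B).1.trace = s := by
  obtain ⟨m, n, hmn, ht⟩ := exists_mul_eq_one_add_eq (s ^ 2 - 2)
  have hs0 : s ≠ 0 := by
    rintro rfl
    norm_num [IsRoot, eval_longitudeTracePoly] at hs
  obtain ⟨h, htr⟩ := (isSurgeryPair_normalForm_iff hmn ht (sub_add_cancel _ _) hs0 rfl).2 <|
    (longitudeTrace_equations_iff rfl).2 ⟨hs, rfl⟩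
  refine ⟨_, _, h, fun hne => ?_, htr⟩
  simpa [coe_companionSL] using congrArg (fun M : SL(2, ℂ) => M.1 1 0) hne.2

/-- The trace of the longitude under a homomorphism to `SL(2, ℂ)`. -/
noncomputable def longitudeTrace (f : PresentedGroup figure8SurgeryRels →* SL(2, ℂ)) : ℂ :=
  (longitudeWord (f (PresentedGroup.of 0)) (f (PresentedGroup.of 1))).1.trace

lemma longitudeTrace_conj {f f' : PresentedGroup figure8SurgeryRels →* SL(2, ℂ)} {g : SL(2, ℂ)}
    (h : ∀ γ, f' γ = g * f γ * g⁻¹) : longitudeTrace f' = longitudeTrace f := by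
  simp only [longitudeTrace, h, longitudeWord_conj, trace_conj_SL]

lemma exists_normalForm_of_ne_one {f : PresentedGroup figure8SurgeryRels →* SL(2, ℂ)}
    (hf : f ≠ 1) {m n : ℂ} (hmn : m * n = 1) (ht : m + n = longitudeTrace f ^ 2 - 2) :
    longitudeTracePoly.IsRoot (longitudeTrace f) ∧ ∃ g : SL(2, ℂ),
      f (PresentedGroup.of 0) = g * upperTriangularSL m n
        (traceMul (longitudeTrace f) - n * (longitudeTrace f ^ 2 - 2)) hmn * g⁻¹ ∧
      f (PresentedGroup.of 1) = g * companionSL (longitudeTrace f ^ 2 - 2) * g⁻¹ :=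
  (isSurgeryPair_of.map f).exists_conj_normalForm
    (fun h => hf (figure8SurgeryHom_ext h.1 h.2)) hmn rfl ht

lemma exists_conj_of_longitudeTrace_eq {f f' : PresentedGroup figure8SurgeryRels →* SL(2, ℂ)}
    (hf : f ≠ 1) (hf' : f' ≠ 1) (h : longitudeTrace f = longitudeTrace f') :
    ∃ g : SL(2, ℂ), ∀ γ, f' γ = g * f γ * g⁻¹ := by
  obtain ⟨m, n, hmn, ht⟩ := exists_mul_eq_one_add_eq (longitudeTrace f ^ 2 - 2)
  obtain ⟨-, g, h₀, h₁⟩ := exists_normalForm_of_ne_one hf hmn ht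
  obtain ⟨-, g', h₀', h₁'⟩ := exists_normalForm_of_ne_one hf' hmn (h ▸ ht)
  rw [← h] at h₀' h₁'
  have key : f' = (MulAut.conj (g' * g⁻¹)).toMonoidHom.comp f := by
    refine figure8SurgeryHom_ext ?_ ?_
    · simp [h₀, h₀', mul_assoc]
    · simp [h₁, h₁', mul_assoc]
  exact ⟨g' * g⁻¹, fun γ => by simp [key, mul_assoc]⟩

end Classification

/-- **The `SL(2,ℂ)` character variety of the `−1/2` surgery on the figure-eight knot.**
The conjugation action of `SL(2,ℂ)` on the set of nontrivial homomorphisms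
`π₁(S³₋₁⸝₂(4₁)) → SL(2,ℂ)` has exactly 7 orbits. -/
theorem card_orbits_figure8_surgery_SL2C :
    Nat.card (Quot (fun f f' :
        {f : PresentedGroup figure8SurgeryRels →* Matrix.SpecialLinearGroup (Fin 2) ℂ //
          f ≠ 1} =>
      ∃ g : Matrix.SpecialLinearGroup (Fin 2) ℂ, ∀ γ, f'.1 γ = g * f.1 γ * g⁻¹)) = 7 := by
  rw [← card_isRoot_longitudeTracePoly]
  refine Nat.card_congr (Equiv.ofBijective (Quot.lift (fun f => ⟨longitudeTrace f.1, ?_⟩) ?_)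
    ⟨?_, ?_⟩)
  · obtain ⟨m, n, hmn, ht⟩ := exists_mul_eq_one_add_eq (longitudeTrace f.1 ^ 2 - 2)
    exact (exists_normalForm_of_ne_one f.2 hmn ht).1
  · rintro f f' ⟨g, hg⟩
    exact Subtype.ext (longitudeTrace_conj hg).symm
  · rintro ⟨f⟩ ⟨f'⟩ h
    exact Quot.sound (exists_conj_of_longitudeTrace_eq f.2 f'.2 (congrArg Subtype.val h))
  · rintro ⟨s, hs⟩
    obtain ⟨A, B, h, hne, htr⟩ := exists_surgeryPair_of_isRoot hs
    refine ⟨Quot.mk _ ⟨h.toHom, fun h1 => hne ⟨?_, ?_⟩⟩, Subtype.ext ?_⟩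
    · exact h.toHom_of_zero.symm.trans (by simp [h1])
    · exact h.toHom_of_one.symm.trans (by simp [h1])
    · simpa only [longitudeTrace, h.toHom_of_zero, h.toHom_of_one] using htr
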